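/- Let 0 < ν < ∞ and define f : ℝ → ℝ by f(x) = e^{−1/|x|^ν} for x ≠ 0 and f(0) = 0. Then f ∈ C^∞(ℝ), all derivatives of f vanish at 0, and there exists C > 0 such that for all n ∈ ℕ and all x ≠ 0, |f^{(n)}(x)| ≤ C^n · e^{−1/(2|x|^ν)} · (n!)^{1+1/ν}. As a consequence, f ∈ G^{1+1/ν}(ℝ), i.e. |f^{(n)}(x)| ≤ C'^n (n!)^{1+1/ν} uniformly in x for some C' > 0. -/

import Mathlib

open Real

noncomputable section

/-- The flat bump `f(x) = e^{-1/|x|^ν}` for `x ≠ 0`, `f(0) = 0`. -/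
def flatExp (ν : ℝ) (x : ℝ) : ℝ :=
  if x = 0 then 0 else Real.exp (-(1 / |x| ^ ν))

/-- The holomorphic extension of `exp (-x ^ (-ν))`, `x > 0`, to the slit plane. -/
def cexpNegCpow (ν : ℝ) (z : ℂ) : ℂ := Complex.exp (-(z ^ (-(ν : ℂ))))

theorem differentiableAt_cexpNegCpow (ν : ℝ) {z : ℂ} (hz : z ∈ Complex.slitPlane) :
    DifferentiableAt ℂ (cexpNegCpow ν) z :=
  ((differentiableAt_id.cpow (differentiableAt_const _) hz).neg).cexp

theorem analyticAt_cexpNegCpow (ν : ℝ) {z : ℂ} (hz : z ∈ Complex.slitPlane) :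
    AnalyticAt ℂ (cexpNegCpow ν) z :=
  DifferentiableOn.analyticAt
    (fun _ hw => (differentiableAt_cexpNegCpow ν hw).differentiableWithinAt)
    (Complex.isOpen_slitPlane.mem_nhds hz)

theorem differentiableAt_iteratedDeriv_cexpNegCpow (ν : ℝ) (n : ℕ) {z : ℂ}
    (hz : z ∈ Complex.slitPlane) :
    DifferentiableAt ℂ (iteratedDeriv n (cexpNegCpow ν)) z :=
  iteratedDeriv_eq_iterate (𝕜 := ℂ) (n := n) (f := cexpNegCpow ν) ▸
    ((analyticAt_cexpNegCpow ν hz).iterated_deriv n).differentiableAt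

theorem flatExp_eq_re {ν x : ℝ} (hx : 0 < x) : flatExp ν x = (cexpNegCpow ν x).re := by
  have h : cexpNegCpow ν x = ((Real.exp (-(1 / |x| ^ ν)) : ℝ) : ℂ) := by
    rw [cexpNegCpow, ← Complex.ofReal_neg, ← Complex.ofReal_cpow hx.le, Real.rpow_neg hx.le,
      abs_of_pos hx, one_div]
    push_cast
    rfl
  rw [h, Complex.ofReal_re, flatExp, if_neg hx.ne']

theorem flatExp_neg (ν x : ℝ) : flatExp ν (-x) = flatExp ν x := by
  simp [flatExp]

theorem iteratedDeriv_flatExp_eq_re (ν : ℝ) (n : ℕ) :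
    ∀ x : ℝ, 0 < x →
      iteratedDeriv n (flatExp ν) x = (iteratedDeriv n (cexpNegCpow ν) x).re := by
  induction n with
  | zero => intro x hx; simpa using flatExp_eq_re hx
  | succ n ih =>
    intro x hx
    have hd := (differentiableAt_iteratedDeriv_cexpNegCpow ν n
      (Complex.ofReal_mem_slitPlane.2 hx)).hasDerivAt.real_of_complex
    have he : iteratedDeriv n (flatExp ν) =ᶠ[nhds x]
        fun y : ℝ => (iteratedDeriv n (cexpNegCpow ν) y).re := by
      filter_upwards [lt_mem_nhds hx] with y hy using ih y hy
    rw [iteratedDeriv_succ, he.deriv_eq, hd.deriv, iteratedDeriv_succ]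

theorem iteratedDeriv_flatExp_neg (ν : ℝ) (n : ℕ) (x : ℝ) :
    iteratedDeriv n (flatExp ν) (-x) = (-1) ^ n * iteratedDeriv n (flatExp ν) x := by
  have h := iteratedDeriv_comp_neg n (flatExp ν) (-x)
  simpa only [flatExp_neg, neg_neg, smul_eq_mul] using h

theorem differentiableAt_iteratedDeriv_flatExp_of_pos (ν : ℝ) (n : ℕ) {x : ℝ} (hx : 0 < x) :
    DifferentiableAt ℝ (iteratedDeriv n (flatExp ν)) x := by
  have hd := (differentiableAt_iteratedDeriv_cexpNegCpow ν n
    (Complex.ofReal_mem_slitPlane.2 hx)).hasDerivAt.real_of_complex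
  refine hd.differentiableAt.congr_of_eventuallyEq ?_
  filter_upwards [lt_mem_nhds hx] with y hy using iteratedDeriv_flatExp_eq_re ν n y hy

theorem differentiableAt_iteratedDeriv_flatExp_of_ne (ν : ℝ) (n : ℕ) {x : ℝ} (hx : x ≠ 0) :
    DifferentiableAt ℝ (iteratedDeriv n (flatExp ν)) x := by
  rcases hx.lt_or_gt with hx | hx
  · have he : iteratedDeriv n (flatExp ν) =
        fun y => (-1) ^ n * iteratedDeriv n (flatExp ν) (-y) := by
      funext y
      rw [← iteratedDeriv_flatExp_neg, neg_neg]
    rw [he]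
    have h1 := differentiableAt_iteratedDeriv_flatExp_of_pos ν n (neg_pos.2 hx)
    exact (h1.comp x differentiableAt_id.neg).const_mul _
  · exact differentiableAt_iteratedDeriv_flatExp_of_pos ν n hx

/-- Negative powers of `x > 0` are absorbed by `exp (-a x ^ (-ν))`. -/
theorem exp_neg_mul_rpow_neg_le {ν a x : ℝ} (hν : 0 < ν) (ha : 0 < a) (hx : 0 < x) (n : ℕ) :
    Real.exp (-(a * x ^ (-ν))) ≤
      x ^ n * (((a * ν) ^ (-(1 / ν))) ^ n * (n.factorial : ℝ) ^ (1 / ν)) := by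
  have hc : 0 < a * ν := mul_pos ha hν
  have ht : 0 < x ^ (-ν) := Real.rpow_pos_of_pos hx _
  have hf : (0 : ℝ) < n.factorial := by exact_mod_cast n.factorial_pos
  have h1 := Real.pow_div_factorial_le_exp (a * ν * x ^ (-ν)) (by positivity) n
  have h2 : Real.exp (-(a * ν * x ^ (-ν))) ≤ n.factorial / (a * ν * x ^ (-ν)) ^ n := by
    rw [Real.exp_neg, ← inv_div]
    exact inv_anti₀ (by positivity) h1
  have h3 := Real.rpow_le_rpow (Real.exp_pos _).le h2 (by positivity : 0 ≤ 1 / ν)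
  have h4 : Real.exp (-(a * ν * x ^ (-ν))) ^ (1 / ν) = Real.exp (-(a * x ^ (-ν))) := by
    rw [← Real.exp_mul]
    congr 1
    field_simp
  have h5 : ((a * ν * x ^ (-ν)) ^ n) ^ (1 / ν) = ((a * ν) ^ (1 / ν)) ^ n * (x ^ n)⁻¹ := by
    rw [← Real.rpow_natCast, ← Real.rpow_mul (by positivity), mul_comm (n : ℝ),
      Real.rpow_mul (by positivity), Real.rpow_natCast, Real.mul_rpow hc.le ht.le, mul_pow,
      ← Real.rpow_mul hx.le, ← inv_pow, ← Real.rpow_neg_one x]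
    congr 3
    field_simp
  rw [h4, Real.div_rpow hf.le (by positivity), h5] at h3
  refine h3.trans_eq ?_
  rw [Real.rpow_neg hc.le, inv_pow, div_eq_mul_inv, mul_inv, inv_inv]
  ring

theorem ofReal_mul_cpow {x : ℝ} (hx : 0 < x) {u : ℂ} (hu : u ≠ 0) (s : ℂ) :
    ((x : ℂ) * u) ^ s = (x : ℂ) ^ s * u ^ s := by
  have hx' : (x : ℂ) ≠ 0 := by exact_mod_cast hx.ne'
  rw [Complex.cpow_def_of_ne_zero (mul_ne_zero hx' hu), Complex.cpow_def_of_ne_zero hx',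
    Complex.cpow_def_of_ne_zero hu, Complex.log_ofReal_mul hx hu, ← Complex.exp_add,
    Complex.ofReal_log hx.le, add_mul]

theorem exists_forall_re_cpow_ge (s : ℂ) :
    ∃ δ : ℝ, 0 < δ ∧ δ < 1 ∧ ∀ u : ℂ, ‖u - 1‖ ≤ δ → 3 / 4 ≤ (u ^ s).re := by
  have hc : ContinuousAt (fun u : ℂ => (u ^ s).re) 1 :=
    Complex.continuous_re.continuousAt.comp
      (continuousAt_id.cpow continuousAt_const (Complex.one_mem_slitPlane))
  have h : ∀ᶠ u : ℂ in nhds 1, 3 / 4 < (u ^ s).re :=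
    hc.eventually (lt_mem_nhds (by norm_num))
  obtain ⟨ε, hε, hb⟩ := Metric.eventually_nhds_iff.1 h
  refine ⟨min (ε / 2) (1 / 2), by positivity, (min_le_right _ _).trans_lt (by norm_num), ?_⟩
  intro u hu
  refine (hb ?_).le
  rw [dist_eq_norm]
  linarith [min_le_left (ε / 2) (1 / 2)]

theorem exists_norm_iteratedDeriv_cexpNegCpow_le (ν : ℝ) :
    ∃ δ : ℝ, 0 < δ ∧ ∀ (n : ℕ) (x : ℝ), 0 < x →
      ‖iteratedDeriv n (cexpNegCpow ν) x‖ ≤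
        n.factorial * Real.exp (-(3 / 4 * x ^ (-ν))) / (δ * x) ^ n := by
  obtain ⟨δ, hδ, hδ1, hre⟩ := exists_forall_re_cpow_ge (-(ν : ℂ))
  refine ⟨δ, hδ, fun n x hx => ?_⟩
  have hx' : (x : ℂ) ≠ 0 := by exact_mod_cast hx.ne'
  have hscale : ∀ z ∈ Metric.closedBall (x : ℂ) (δ * x), ‖z / x - 1‖ ≤ δ := by
    intro z hz
    rw [mem_closedBall_iff_norm] at hz
    rw [div_sub_one hx', norm_div, Complex.norm_real, Real.norm_of_nonneg hx.le,
      div_le_iff₀ hx]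
    exact hz
  have hslit : ∀ z ∈ Metric.closedBall (x : ℂ) (δ * x), z ∈ Complex.slitPlane := by
    intro z hz
    rw [mem_closedBall_iff_norm] at hz
    have h1 := (abs_le.1 ((Complex.abs_re_le_norm (z - x)).trans hz)).1
    rw [Complex.sub_re, Complex.ofReal_re] at h1
    exact Or.inl (by nlinarith)
  have hdiff : DiffContOnCl ℂ (cexpNegCpow ν) (Metric.ball (x : ℂ) (δ * x)) :=
    DifferentiableOn.diffContOnCl_ball
      (fun z hz => (differentiableAt_cexpNegCpow ν (hslit z hz)).differentiableWithinAt)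
      subset_rfl
  refine Complex.norm_iteratedDeriv_le_of_forall_mem_sphere_norm_le n (mul_pos hδ hx) hdiff ?_
  intro z hz
  have hz' := Metric.sphere_subset_closedBall hz
  have hz0 : z / x ≠ 0 := div_ne_zero (Complex.slitPlane_ne_zero (hslit z hz')) hx'
  have hpow : z ^ (-(ν : ℂ)) = ((x ^ (-ν) : ℝ) : ℂ) * (z / x) ^ (-(ν : ℂ)) := by
    conv_lhs => rw [← mul_div_cancel₀ z hx']
    rw [ofReal_mul_cpow hx hz0, Complex.ofReal_cpow hx.le, Complex.ofReal_neg]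
  rw [cexpNegCpow, Complex.norm_exp, Real.exp_le_exp, hpow, Complex.neg_re, Complex.re_ofReal_mul,
    neg_le_neg_iff, mul_comm]
  exact mul_le_mul_of_nonneg_left (hre _ (hscale z hz')) (Real.rpow_pos_of_pos hx _).le

theorem exists_abs_iteratedDeriv_flatExp_le {ν : ℝ} (hν : 0 < ν) :
    ∃ C > (0 : ℝ), ∀ n : ℕ, ∀ x : ℝ, x ≠ 0 →
      |iteratedDeriv n (flatExp ν) x| ≤
        C ^ n * Real.exp (-(1 / (2 * |x| ^ ν))) * ((n.factorial : ℝ)) ^ (1 + 1 / ν) := by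
  obtain ⟨δ, hδ, hbound⟩ := exists_norm_iteratedDeriv_cexpNegCpow_le ν
  have hA : 0 < (1 / 4 * ν) ^ (-(1 / ν)) := Real.rpow_pos_of_pos (by positivity) _
  set A := (1 / 4 * ν) ^ (-(1 / ν)) with hAdef
  have hpos : ∀ n : ℕ, ∀ x : ℝ, 0 < x → |iteratedDeriv n (flatExp ν) x| ≤
      (A / δ) ^ n * Real.exp (-(1 / (2 * |x| ^ ν))) * ((n.factorial : ℝ)) ^ (1 + 1 / ν) := by
    intro n x hx
    have hf : (0 : ℝ) < n.factorial := by exact_mod_cast n.factorial_pos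
    have hsplit : Real.exp (-(3 / 4 * x ^ (-ν))) =
        Real.exp (-(1 / (2 * |x| ^ ν))) * Real.exp (-(1 / 4 * x ^ (-ν))) := by
      rw [← Real.exp_add, abs_of_pos hx, Real.rpow_neg hx.le]
      congr 1
      field_simp
      norm_num
    rw [iteratedDeriv_flatExp_eq_re ν n x hx]
    calc |(iteratedDeriv n (cexpNegCpow ν) x).re|
        ≤ n.factorial * Real.exp (-(3 / 4 * x ^ (-ν))) / (δ * x) ^ n :=
          (Complex.abs_re_le_norm _).trans (hbound n x hx)
      _ ≤ n.factorial * (Real.exp (-(1 / (2 * |x| ^ ν))) *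
            (x ^ n * (A ^ n * (n.factorial : ℝ) ^ (1 / ν)))) / (δ * x) ^ n := by
          rw [hsplit]
          gcongr
          exact exp_neg_mul_rpow_neg_le hν (by norm_num) hx n
      _ = _ := by
          rw [Real.rpow_add hf, Real.rpow_one, div_pow, mul_pow]
          field_simp
  refine ⟨A / δ, by positivity, fun n x hx => ?_⟩
  rcases hx.lt_or_gt with hx | hx
  · have h := hpos n (-x) (neg_pos.2 hx)
    rwa [iteratedDeriv_flatExp_neg, abs_mul, abs_pow, abs_neg, abs_one, one_pow, one_mul,
      abs_neg] at h
  · exact hpos n x hx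

theorem exists_abs_iteratedDeriv_flatExp_le_sq {ν : ℝ} (hν : 0 < ν) (n : ℕ) :
    ∃ K : ℝ, ∀ x : ℝ, x ≠ 0 → |iteratedDeriv n (flatExp ν) x| ≤ K * x ^ 2 := by
  obtain ⟨C, hC, hb⟩ := exists_abs_iteratedDeriv_flatExp_le hν
  refine ⟨C ^ n * (((1 / 2 * ν) ^ (-(1 / ν))) ^ 2 * (Nat.factorial 2 : ℝ) ^ (1 / ν)) *
    (n.factorial : ℝ) ^ (1 + 1 / ν), fun x hx => (hb n x hx).trans ?_⟩
  have h := exp_neg_mul_rpow_neg_le hν (by norm_num : (0 : ℝ) < 1 / 2) (abs_pos.2 hx) 2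
  have he : 1 / 2 * |x| ^ (-ν) = 1 / (2 * |x| ^ ν) := by
    rw [Real.rpow_neg (abs_nonneg x)]
    field_simp
  rw [he, sq_abs] at h
  calc _ ≤ C ^ n * (x ^ 2 * (((1 / 2 * ν) ^ (-(1 / ν))) ^ 2 *
        (Nat.factorial 2 : ℝ) ^ (1 / ν))) * (n.factorial : ℝ) ^ (1 + 1 / ν) := by gcongr
    _ = _ := by ring

theorem hasDerivAt_zero_of_abs_le_sq {g : ℝ → ℝ} {K : ℝ} (h0 : g 0 = 0)
    (h : ∀ x, x ≠ 0 → |g x| ≤ K * x ^ 2) : HasDerivAt g 0 0 := by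
  have hO : g =O[nhds 0] fun x : ℝ => x ^ 2 := by
    refine Asymptotics.IsBigO.of_bound K (Filter.Eventually.of_forall fun x => ?_)
    rcases eq_or_ne x 0 with rfl | hx
    · simp [h0]
    · simpa using h x hx
  rw [hasDerivAt_iff_isLittleO]
  simpa [h0] using hO.trans_isLittleO (Asymptotics.isLittleO_pow_id one_lt_two)

theorem iteratedDeriv_flatExp_zero {ν : ℝ} (hν : 0 < ν) (n : ℕ) :
    iteratedDeriv n (flatExp ν) 0 = 0 := by
  induction n with
  | zero => simp [flatExp]
  | succ n ih =>
    obtain ⟨K, hK⟩ := exists_abs_iteratedDeriv_flatExp_le_sq hν n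
    rw [iteratedDeriv_succ, (hasDerivAt_zero_of_abs_le_sq ih hK).deriv]

theorem differentiable_iteratedDeriv_flatExp {ν : ℝ} (hν : 0 < ν) (n : ℕ) :
    Differentiable ℝ (iteratedDeriv n (flatExp ν)) := by
  intro x
  rcases eq_or_ne x 0 with rfl | hx
  · obtain ⟨K, hK⟩ := exists_abs_iteratedDeriv_flatExp_le_sq hν n
    exact (hasDerivAt_zero_of_abs_le_sq (iteratedDeriv_flatExp_zero hν n) hK).differentiableAt
  · exact differentiableAt_iteratedDeriv_flatExp_of_ne ν n hx

/-- **Lemma 2.4**: for `0 < ν < ∞` the function `f(x) = e^{-1/|x|^ν}` (with `f(0) = 0`)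
is smooth, all of its derivatives vanish at `0`, and there is `C > 0` with
`|f^{(n)}(x)| ≤ Cⁿ e^{-1/(2|x|^ν)} (n!)^{1+1/ν}` for all `n` and `x ≠ 0`.
Consequently `f` belongs to the Gevrey class `G^{1+1/ν}(ℝ)`. -/
theorem flatExp_gevrey (ν : ℝ) (hν : 0 < ν) :
    ContDiff ℝ (⊤ : ℕ∞) (flatExp ν) ∧
    (∀ n : ℕ, iteratedDeriv n (flatExp ν) 0 = 0) ∧
    (∃ C > (0 : ℝ), ∀ n : ℕ, ∀ x : ℝ, x ≠ 0 →
      |iteratedDeriv n (flatExp ν) x| ≤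
        C ^ n * Real.exp (-(1 / (2 * |x| ^ ν))) * ((n.factorial : ℝ)) ^ (1 + 1 / ν)) ∧
    (∃ C' > (0 : ℝ), ∀ n : ℕ, ∀ x : ℝ,
      |iteratedDeriv n (flatExp ν) x| ≤ C' ^ n * ((n.factorial : ℝ)) ^ (1 + 1 / ν)) := by
  obtain ⟨C, hC, hb⟩ := exists_abs_iteratedDeriv_flatExp_le hν
  refine ⟨contDiff_of_differentiable_iteratedDeriv
    fun n _ => differentiable_iteratedDeriv_flatExp hν n, iteratedDeriv_flatExp_zero hν,
    ⟨C, hC, hb⟩, C, hC, fun n x => ?_⟩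
  rcases eq_or_ne x 0 with rfl | hx
  · rw [iteratedDeriv_flatExp_zero hν, abs_zero]
    positivity
  · refine (hb n x hx).trans ?_
    gcongr
    refine mul_le_of_le_one_right (by positivity) (Real.exp_le_one_iff.2 ?_)
    exact neg_nonpos.2 (by positivity)

end
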